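/- arXiv:2002.07735 — 2 statements merged into one kernel-verified Lean document; each statement's English description precedes it below -/
import Mathlib

section
/- For every ℓ ≥ 0 and all x, y ∈ Z^d: E[ξ^ℓ_x ξ^ℓ_y] = (1/2) q̃_{2ℓ}(x,y); moreover, for x, y ∈ Z^d one has q̃_{2ℓ}(x,y) = q_ℓ(x,y), the ℓ-step kernel of the lazy simple random walk on Z^d; and, for d ≥ 3, g(x,y) = (1/2) Σ_{ℓ≥0} q_ℓ(x,y), the series being convergent. In particular E[ξ^ℓ_x ξ^ℓ_y] = 0 whenever |x−y|_∞ > ℓ. -/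
open MeasureTheory ProbabilityTheory Filter Set

namespace GFFperc

noncomputable section

/-- The lattice `ℤ^d`. -/
abbrev V (d : ℕ) := Fin d → ℤ

/-- Nearest-neighbour adjacency on `ℤ^d`. -/
def adj {d : ℕ} (x y : V d) : Prop := (∑ i, (x i - y i).natAbs) = 1

/-- `ℓ∞` distance between two points. -/
def dinf {d : ℕ} (x y : V d) : ℕ := Finset.univ.sup fun i => (x i - y i).natAbs

/-- `A` and `B` are joined by a nearest-neighbour path contained in `S`. -/
def ConnIn {d : ℕ} (S A B : Set (V d)) : Prop :=
  ∃ (n : ℕ) (γ : ℕ → V d), γ 0 ∈ A ∧ γ n ∈ B ∧ (∀ k, k ≤ n → γ k ∈ S) ∧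
    ∀ k, k < n → adj (γ k) (γ (k + 1))

/-- A set is connected: any two of its points are joined inside it. -/
def IsConnSet {d : ℕ} (S : Set (V d)) : Prop := ∀ x ∈ S, ∀ y ∈ S, ConnIn S {x} {y}

/-- The connected component of `x` in `S`. -/
def comp {d : ℕ} (S : Set (V d)) (x : V d) : Set (V d) := {y | ConnIn S {x} {y}}

/-- Box of (real) radius `r` centered at `x`. -/
def boxAt {d : ℕ} (x : V d) (r : ℝ) : Set (V d) := {y | ∀ i, |(y i : ℝ) - (x i : ℝ)| ≤ r}

def box (d : ℕ) (r : ℝ) : Set (V d) := boxAt (0 : V d) r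

/-- Inner vertex boundary of the box of radius `r` centered at `x`. -/
def bdryAt {d : ℕ} (x : V d) (r : ℝ) : Set (V d) :=
  {y | y ∈ boxAt x r ∧ ∃ z, z ∉ boxAt x r ∧ adj y z}

def bdry (d : ℕ) (r : ℝ) : Set (V d) := bdryAt (0 : V d) r

/-- `A` is connected to infinity within `S`. -/
def ConnToInf {d : ℕ} (S A : Set (V d)) : Prop := ∀ R : ℕ, 1 ≤ R → ConnIn S A (bdry d R)

/-- The `ℓ∞`-diameter of `S` is at least `r`. -/
def diamGE {d : ℕ} (S : Set (V d)) (r : ℝ) : Prop := ∃ x ∈ S, ∃ y ∈ S, r ≤ (dinf x y : ℝ)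

def unitV (d : ℕ) (i : Fin d) : V d := fun j => if j = i then 1 else 0

/-- `k`-step transition probabilities of simple random walk on `ℤ^d`. -/
def srwP (d : ℕ) : ℕ → V d → V d → ℝ
  | 0, x, y => if x = y then 1 else 0
  | (k + 1), x, y =>
      (1 / (2 * d)) * ∑ i : Fin d, (srwP d k (x + unitV d i) y + srwP d k (x - unitV d i) y)

/-- Green function of simple random walk on `ℤ^d`. -/
def green (d : ℕ) (x y : V d) : ℝ := ∑' k : ℕ, srwP d k x y

/-- `ℓ`-step transition kernel of the lazy simple random walk on `ℤ^d`. -/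
def lazyP (d : ℕ) : ℕ → V d → V d → ℝ
  | 0, x, y => if x = y then 1 else 0
  | (k + 1), x, y =>
      (1 / 2) * lazyP d k x y +
        (1 / (4 * d)) * ∑ i : Fin d, (lazyP d k (x + unitV d i) y + lazyP d k (x - unitV d i) y)

/-- `φ` is a centered Gaussian field with covariance function `C`: every finite linear
combination is a centered Gaussian variable with the corresponding variance. -/
def IsCGF {Ω : Type*} [MeasurableSpace Ω] {d : ℕ} (P : Measure Ω)
    (φ : V d → Ω → ℝ) (C : V d → V d → ℝ) : Prop :=
  (∀ x, Measurable (φ x)) ∧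
    ∀ (s : Finset (V d)) (a : V d → ℝ),
      Measure.map (fun ω => ∑ x ∈ s, a x * φ x ω) P =
        gaussianReal 0 (Real.toNNReal (∑ x ∈ s, ∑ y ∈ s, a x * a y * C x y))

/-- `φ` is a Gaussian free field on `ℤ^d`. -/
def IsGFF {Ω : Type*} [MeasurableSpace Ω] {d : ℕ} (P : Measure Ω) (φ : V d → Ω → ℝ) : Prop :=
  IsCGF P φ (green d)

/-- The level set `{φ ≥ h}`. -/
def lvl {d : ℕ} {Ω : Type*} (φ : V d → Ω → ℝ) (h : ℝ) (ω : Ω) : Set (V d) := {x | h ≤ φ x ω}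

/-- The whole field, as one random variable with values in `V d → ℝ`. -/
def proc {Ω : Type*} {d : ℕ} (φ : V d → Ω → ℝ) : Ω → V d → ℝ := fun ω x => φ x ω

/-- The critical parameter `h_*`. -/
def hStar (d : ℕ) {Ω : Type*} [MeasurableSpace Ω] (P : Measure Ω) (φ : V d → Ω → ℝ) : ℝ :=
  sInf {h : ℝ | P {ω | ConnToInf (lvl φ h ω) {(0 : V d)}} = 0}

/-- The critical parameter `h_{**}`. -/
def hStarStar (d : ℕ) {Ω : Type*} [MeasurableSpace Ω] (P : Measure Ω) (φ : V d → Ω → ℝ) : ℝ :=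
  sInf {h : ℝ |
    (⨅ R : ℕ, P {ω | ConnIn (lvl φ h ω) (box d ((R : ℝ) + 1)) (bdry d (2 * ((R : ℝ) + 1)))}) = 0}

/-- `u(R) = exp((log R)^{1/3})`. -/
def ufn (R : ℝ) : ℝ := Real.exp (Real.log R ^ ((1 : ℝ) / 3))

def tildeSet (d : ℕ) {Ω : Type*} [MeasurableSpace Ω] (P : Measure Ω) (φ : V d → Ω → ℝ) :
    Set ℝ :=
  {h : ℝ |
    (⨅ R : ℕ, ENNReal.ofReal (((R : ℝ) + 1) ^ d) *
        P {ω | ¬ ConnIn (lvl φ h ω) (box d (ufn ((R : ℝ) + 1))) (bdry d ((R : ℝ) + 1))}) = 0}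

/-- The critical parameter `h̃`. -/
def hTilde (d : ℕ) {Ω : Type*} [MeasurableSpace Ω] (P : Measure Ω) (φ : V d → Ω → ℝ) : ℝ :=
  sSup (tildeSet d P φ)

/-- The event `Exist(R,α)`. -/
def ExistEv (d : ℕ) {Ω : Type*} (φ : V d → Ω → ℝ) (R : ℕ) (α : ℝ) : Set Ω :=
  {ω | ∃ x ∈ lvl φ α ω ∩ box d (R : ℝ),
    diamGE (comp (lvl φ α ω ∩ box d (R : ℝ)) x) ((R : ℝ) / 5)}

/-- The event `Unique(R,α)`. -/
def UniqueEv (d : ℕ) {Ω : Type*} (φ : V d → Ω → ℝ) (R : ℕ) (α : ℝ) : Set Ω :=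
  {ω | ∀ x ∈ lvl φ α ω ∩ box d (R : ℝ), ∀ y ∈ lvl φ α ω ∩ box d (R : ℝ),
    diamGE (comp (lvl φ α ω ∩ box d (R : ℝ)) x) ((R : ℝ) / 10) →
    diamGE (comp (lvl φ α ω ∩ box d (R : ℝ)) y) ((R : ℝ) / 10) →
    ConnIn (lvl φ α ω ∩ box d (2 * (R : ℝ))) {x} {y}}

/-- `φ` strongly percolates up to level `h`. -/
def StronglyPerc (d : ℕ) {Ω : Type*} [MeasurableSpace Ω] (P : Measure Ω)
    (φ : V d → Ω → ℝ) (h : ℝ) : Prop :=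
  ∃ c : ℝ, 0 < c ∧ ∃ ρ : ℝ, ρ ∈ Set.Ioc (0 : ℝ) 1 ∧
    ∀ α : ℝ, α ≤ h → ∀ R : ℕ, 1 ≤ R →
      ENNReal.ofReal (1 - Real.exp (-c * (R : ℝ) ^ ρ)) ≤ P (ExistEv d φ R α) ∧
      ENNReal.ofReal (1 - Real.exp (-c * (R : ℝ) ^ ρ)) ≤ P (UniqueEv d φ R α)

/-- The critical parameter `h̄`. -/
def hBar (d : ℕ) {Ω : Type*} [MeasurableSpace Ω] (P : Measure Ω) (φ : V d → Ω → ℝ) : ℝ :=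
  sSup {h : ℝ | StronglyPerc d P φ h}


/-- Number of odd coordinates of `v` (in the doubled-coordinate picture of `Z̃^d`,
points of `ℤ^d` have no odd coordinate and midpoints exactly one). -/
def nOdd {d : ℕ} (v : V d) : ℕ := (Finset.univ.filter fun i => v i % 2 ≠ 0).card

/-- `v` represents a vertex of `Z̃^d` (in doubled coordinates). -/
def inTV {d : ℕ} (v : V d) : Prop := nOdd v ≤ 1

/-- Degree of a vertex of `Z̃^d`: `2d` for points of `ℤ^d`, `2` for midpoints. -/
def tDeg (d : ℕ) (v : V d) : ℕ := if nOdd v = 0 then 2 * d else 2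

/-- `ℓ`-step transition probabilities `q̃_ℓ` of simple random walk on `Z̃^d`
(in doubled coordinates). -/
def tq (d : ℕ) : ℕ → V d → V d → ℝ
  | 0, v, w => if v = w then 1 else 0
  | (ℓ + 1), v, w =>
      (1 / (tDeg d v)) * ∑ i : Fin d,
        ((if nOdd (v + unitV d i) ≤ 1 then tq d ℓ (v + unitV d i) w else 0) +
          (if nOdd (v - unitV d i) ≤ 1 then tq d ℓ (v - unitV d i) w else 0))

/-- Doubling of coordinates, embedding `ℤ^d` into `Z̃^d`. -/
def dbl {d : ℕ} (x : V d) : V d := fun i => 2 * x i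

/-- `Z` is an i.i.d. family of standard Gaussian random variables. -/
def IsIIDStdGauss {Ω : Type*} [MeasurableSpace Ω] {ι : Type*} (P : Measure Ω)
    (Z : ι → Ω → ℝ) : Prop :=
  (∀ i, Measurable (Z i)) ∧ (∀ i, Measure.map (Z i) P = gaussianReal 0 1) ∧
    iIndepFun Z P

/-- The finite-range fields `ξ^ℓ` of (3.3). -/
def xiF (d : ℕ) {Ω : Type*} (Z : ℕ → V d → Ω → ℝ) (ℓ : ℕ) (x : V d) (ω : Ω) : ℝ :=
  (if ℓ % 2 = 1 then Real.sqrt (d / 2) else Real.sqrt (1 / 2)) *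
    ∑' z : V d, tq d ℓ (dbl x) z * Z ℓ z ω

/-- The one-step averaging operator of simple random walk on `ℤ^d`. -/
def srwAvg (d : ℕ) (f : V d → ℝ) (x : V d) : ℝ :=
  (1 / (2 * d)) * ∑ i : Fin d, (f (x + unitV d i) + f (x - unitV d i))

lemma srwAvg_mono {d : ℕ} {f g : V d → ℝ} (h : ∀ x, f x ≤ g x) (x : V d) :
    srwAvg d f x ≤ srwAvg d g x := by
  unfold srwAvg
  gcongr <;> apply h

lemma srwAvg_const_mul {d : ℕ} (c : ℝ) (f : V d → ℝ) (x : V d) :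
    srwAvg d (fun z => c * f z) x = c * srwAvg d f x := by
  simp only [srwAvg, ← mul_add, ← Finset.mul_sum]
  ring

lemma srwAvg_sum {d : ℕ} {ι : Type*} (s : Finset ι) (f : ι → V d → ℝ) (x : V d) :
    srwAvg d (fun z => ∑ k ∈ s, f k z) x = ∑ k ∈ s, srwAvg d (f k) x := by
  simp only [srwAvg, ← Finset.sum_add_distrib, ← Finset.mul_sum]
  rw [Finset.sum_comm]

lemma srwP_succ (d k : ℕ) (x y : V d) :
    srwP d (k + 1) x y = srwAvg d (fun z => srwP d k z y) x := rfl

lemma lazyP_succ (d k : ℕ) (x y : V d) :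
    lazyP d (k + 1) x y =
      (1 / 2) * lazyP d k x y + (1 / 2) * srwAvg d (fun z => lazyP d k z y) x := by
  simp only [lazyP, srwAvg]
  ring

lemma srwP_nonneg (d k : ℕ) (x y : V d) : 0 ≤ srwP d k x y := by
  induction k generalizing x with
  | zero => simp only [srwP]; split_ifs <;> norm_num
  | succ k ih =>
    simp only [srwP]
    exact mul_nonneg (by positivity) (Finset.sum_nonneg fun i _ => add_nonneg (ih _) (ih _))

lemma lazyP_nonneg (d k : ℕ) (x y : V d) : 0 ≤ lazyP d k x y := by
  induction k generalizing x with
  | zero => simp only [lazyP]; split_ifs <;> norm_num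
  | succ k ih =>
    simp only [lazyP]
    exact add_nonneg (mul_nonneg (by norm_num) (ih x)) <| mul_nonneg (by positivity) <|
      Finset.sum_nonneg fun i _ => add_nonneg (ih _) (ih _)

lemma sum_srwP_le_of_supersolution {d : ℕ} {y : V d} {h : V d → ℝ} (h0 : ∀ x, 0 ≤ h x)
    (hs : ∀ x, (if x = y then 1 else 0) + srwAvg d h x ≤ h x) (n : ℕ) (x : V d) :
    ∑ k ∈ Finset.range n, srwP d k x y ≤ h x := by
  induction n generalizing x with
  | zero => simpa using h0 x
  | succ n ih =>
    rw [Finset.sum_range_succ']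
    simp only [srwP_succ, ← srwAvg_sum]
    have := srwAvg_mono ih x
    have := hs x
    simp only [srwP]
    linarith

lemma sum_lazyP_le_of_supersolution {d : ℕ} {y : V d} {h : V d → ℝ} (h0 : ∀ x, 0 ≤ h x)
    (hs : ∀ x, (if x = y then 1 else 0) + srwAvg d h x ≤ h x) (n : ℕ) (x : V d) :
    ∑ k ∈ Finset.range n, (1 / 2) * lazyP d k x y ≤ h x := by
  induction n generalizing x with
  | zero => simpa using h0 x
  | succ n ih =>
    rw [Finset.sum_range_succ']
    have h1 := srwAvg_mono ih x
    have h2 := hs x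
    have h3 := ih x
    rw [srwAvg_sum] at h1
    simp only [srwAvg_const_mul] at h1
    simp only [lazyP_succ, mul_add, Finset.sum_add_distrib, ← Finset.mul_sum] at h1 h3 ⊢
    simp only [lazyP]
    linarith

lemma srwAvg_tsum {d : ℕ} {f : ℕ → V d → ℝ} (hf : ∀ x, Summable fun k => f k x) (x : V d) :
    srwAvg d (fun z => ∑' k, f k z) x = ∑' k, srwAvg d (f k) x := by
  have h : ∀ i, HasSum (fun k => f k (x + unitV d i) + f k (x - unitV d i))
      (∑' k, f k (x + unitV d i) + ∑' k, f k (x - unitV d i)) :=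
    fun i => (hf _).hasSum.add (hf _).hasSum
  exact ((hasSum_sum fun i _ => h i).mul_left _).tsum_eq.symm

lemma summable_srwAvg {d : ℕ} {f : ℕ → V d → ℝ} (hf : ∀ x, Summable fun k => f k x) (x : V d) :
    Summable fun k => srwAvg d (f k) x :=
  (summable_sum fun _ _ => (hf _).add (hf _)).mul_left _

lemma green_eq {d : ℕ} {y : V d} (hS : ∀ x, Summable fun k => srwP d k x y) (x : V d) :
    green d x y = (if x = y then 1 else 0) + srwAvg d (fun z => green d z y) x := by
  unfold green
  rw [srwAvg_tsum hS, (hS x).tsum_eq_zero_add]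
  rfl

lemma half_tsum_lazyP_eq {d : ℕ} {y : V d} (hS : ∀ x, Summable fun k => (1 / 2) * lazyP d k x y)
    (x : V d) :
    ∑' k, (1 / 2) * lazyP d k x y =
      (if x = y then 1 else 0) + srwAvg d (fun z => ∑' k, (1 / 2) * lazyP d k z y) x := by
  have h1 := (hS x).tsum_eq_zero_add
  have h2 : ∑' k, (1 / 2) * lazyP d (k + 1) x y =
      (1 / 2) * ∑' k, (1 / 2) * lazyP d k x y +
        (1 / 2) * ∑' k, srwAvg d (fun z => (1 / 2) * lazyP d k z y) x := by
    rw [← tsum_mul_left, ← tsum_mul_left,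
      ← ((hS x).mul_left _).tsum_add ((summable_srwAvg hS x).mul_left _)]
    simp only [lazyP_succ, srwAvg_const_mul, mul_add]
  rw [h2, ← srwAvg_tsum hS] at h1
  simp only [lazyP] at h1
  linarith

lemma hasSum_half_lazyP {d : ℕ} {y : V d} (hS : ∀ x, Summable fun k => srwP d k x y) (x : V d) :
    HasSum (fun k => (1 / 2) * lazyP d k x y) (green d x y) := by
  have hl0 : ∀ x k, 0 ≤ (1 / 2) * lazyP d k x y :=
    fun x k => mul_nonneg (by norm_num) (lazyP_nonneg d k x y)
  have hle := sum_lazyP_le_of_supersolution (h := fun z => green d z y)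
    (fun z => tsum_nonneg fun k => srwP_nonneg d k z y) (fun z => (green_eq hS z).ge)
  have hL : ∀ x, Summable fun k => (1 / 2) * lazyP d k x y := fun x =>
    summable_of_sum_range_le (hl0 x) fun n => hle n x
  have hge := sum_srwP_le_of_supersolution (h := fun z => ∑' k, (1 / 2) * lazyP d k z y)
    (fun z => tsum_nonneg (hl0 z)) (fun z => (half_tsum_lazyP_eq hL z).ge)
  have hg : green d x y = ∑' k, (1 / 2) * lazyP d k x y :=
    (Real.tsum_le_of_sum_range_le (srwP_nonneg d · x y) fun n => hge n x).antisymm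
      (Real.tsum_le_of_sum_range_le (hl0 x) fun n => hle n x)
  exact hg ▸ (hL x).hasSum

lemma rpow_neg_quarter_le {w : ℝ} (h : |w| ≤ 1 / 30) :
    (1 + w) ^ (-(1 / 4) : ℝ) ≤ 1 - w / 4 + 11 / 64 * w ^ 2 := by
  obtain ⟨h1, h2⟩ := abs_le.1 h
  set Q := 1 - w / 4 + 11 / 64 * w ^ 2 with hQ
  have hQ0 : 0 < Q := by nlinarith [sq_nonneg w]
  have hw : 0 < 1 + w := by linarith
  have hQ2 : 1 - w / 2 + 2 / 5 * w ^ 2 ≤ Q ^ 2 := by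
    have : Q ^ 2 - (1 - w / 2 + 2 / 5 * w ^ 2) =
        w ^ 2 * (1 / 160 - 11 / 128 * w + 121 / 4096 * w ^ 2) := by rw [hQ]; ring
    have : 0 ≤ w ^ 2 * (1 / 160 - 11 / 128 * w + 121 / 4096 * w ^ 2) :=
      mul_nonneg (sq_nonneg w) (by nlinarith [sq_nonneg w])
    linarith
  have hQ4 : 1 ≤ (1 + w) * Q ^ 4 := by
    have h3 : (1 - w / 2 + 2 / 5 * w ^ 2) ^ 2 ≤ (Q ^ 2) ^ 2 :=
      pow_le_pow_left₀ (by nlinarith [sq_nonneg w]) hQ2 2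
    have h4 : (1 + w) * (1 - w / 2 + 2 / 5 * w ^ 2) ^ 2 - 1 =
        w ^ 2 * (1 / 20 + 13 / 20 * w - 6 / 25 * w ^ 2 + 4 / 25 * w ^ 3) := by ring
    have h5 : 0 ≤ w ^ 2 * (1 / 20 + 13 / 20 * w - 6 / 25 * w ^ 2 + 4 / 25 * w ^ 3) := by
      have h6 : w ^ 2 ≤ 1 / 900 := by nlinarith
      have h7 : -(1 / 900) ≤ w ^ 3 := by nlinarith [sq_nonneg w]
      exact mul_nonneg (sq_nonneg w) (by linarith)
    nlinarith [mul_le_mul_of_nonneg_left h3 hw.le]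
  calc (1 + w) ^ (-(1 / 4) : ℝ) = ((1 + w)⁻¹) ^ (1 / 4 : ℝ) := by
        rw [Real.rpow_neg hw.le, Real.inv_rpow hw.le]
    _ ≤ (Q ^ 4) ^ (1 / 4 : ℝ) := by
        refine Real.rpow_le_rpow (inv_nonneg.2 hw.le) ?_ (by norm_num)
        rw [inv_le_iff_one_le_mul₀ hw]
        linarith
    _ = Q := by
        rw [← Real.rpow_natCast, ← Real.rpow_mul hQ0.le]
        norm_num

/-- The shifted squared Euclidean norm `|x|² + 1000 d`. -/
def shiftedSq (d : ℕ) (x : V d) : ℝ := ∑ i, (x i : ℝ) ^ 2 + 1000 * d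

lemma shiftedSq_add_unitV {d : ℕ} (x : V d) (i : Fin d) :
    shiftedSq d (x + unitV d i) = shiftedSq d x + (1 + 2 * x i) := by
  have h : ∀ j, (((x + unitV d i) j : ℤ) : ℝ) ^ 2 =
      (x j : ℝ) ^ 2 + if j = i then (1 + 2 * x i : ℝ) else 0 := by
    intro j
    by_cases hj : j = i
    · subst hj; simp [unitV]; ring
    · simp [unitV, hj]
  simp only [shiftedSq, h, Finset.sum_add_distrib, Finset.sum_ite_eq', Finset.mem_univ, if_true]
  ring

lemma shiftedSq_sub_unitV {d : ℕ} (x : V d) (i : Fin d) :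
    shiftedSq d (x - unitV d i) = shiftedSq d x + (1 - 2 * x i) := by
  have h := shiftedSq_add_unitV (x - unitV d i) i
  rw [sub_add_cancel] at h
  have : ((x - unitV d i) i : ℤ) = x i - 1 := by simp [unitV]
  rw [this] at h
  push_cast at h
  linarith

lemma shiftedSq_rpow_le {d : ℕ} (hd : 3 ≤ d) (x : V d) (i : Fin d) {u : ℝ}
    (hu : |u| = 2 * |(x i : ℝ)|) :
    (shiftedSq d x + (1 + u)) ^ (-(1 / 4) : ℝ) ≤ shiftedSq d x ^ (-(1 / 4) : ℝ) *
      (1 - ((1 + u) / shiftedSq d x) / 4 + 11 / 64 * ((1 + u) / shiftedSq d x) ^ 2) := by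
  have hd' : (3 : ℝ) ≤ d := by exact_mod_cast hd
  have hx : (x i : ℝ) ^ 2 ≤ ∑ j, (x j : ℝ) ^ 2 :=
    Finset.single_le_sum (f := fun j => (x j : ℝ) ^ 2) (fun j _ => sq_nonneg _) (Finset.mem_univ i)
  have hs : (x i : ℝ) ^ 2 + 3000 ≤ shiftedSq d x := by unfold shiftedSq; linarith
  set s := shiftedSq d x
  have hs0 : 0 < s := by nlinarith [sq_nonneg (x i : ℝ)]
  have hw : |(1 + u) / s| ≤ 1 / 30 := by
    rw [abs_div, abs_of_pos hs0, div_le_iff₀ hs0]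
    have := abs_add_le 1 u
    rw [abs_one] at this
    nlinarith [sq_abs (x i : ℝ), sq_nonneg (|(x i : ℝ)| - 30)]
  have h1 : s + (1 + u) = s * (1 + (1 + u) / s) := by field_simp
  rw [h1, Real.mul_rpow hs0.le (by linarith [(abs_le.1 hw).1])]
  exact mul_le_mul_of_nonneg_left (rpow_neg_quarter_le hw) (by positivity)

lemma srwAvg_shiftedSq_rpow_lt {d : ℕ} (hd : 3 ≤ d) (x : V d) :
    srwAvg d (fun z => shiftedSq d z ^ (-(1 / 4) : ℝ)) x < shiftedSq d x ^ (-(1 / 4) : ℝ) := by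
  have hd' : (3 : ℝ) ≤ d := by exact_mod_cast hd
  have hN : 0 ≤ ∑ j, (x j : ℝ) ^ 2 := Finset.sum_nonneg fun j _ => sq_nonneg _
  have hs : shiftedSq d x = ∑ j, (x j : ℝ) ^ 2 + 1000 * d := rfl
  have hs0 : 0 < shiftedSq d x := by linarith
  have hle : ∑ i : Fin d, (shiftedSq d (x + unitV d i) ^ (-(1 / 4) : ℝ) +
      shiftedSq d (x - unitV d i) ^ (-(1 / 4) : ℝ)) ≤
      ∑ i : Fin d, shiftedSq d x ^ (-(1 / 4) : ℝ) * (2 - 1 / (2 * shiftedSq d x) +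
        11 / 32 * (1 + 4 * (x i : ℝ) ^ 2) / shiftedSq d x ^ 2) := by
    refine Finset.sum_le_sum fun i _ => ?_
    rw [shiftedSq_add_unitV, shiftedSq_sub_unitV]
    have h1 := shiftedSq_rpow_le hd x i (u := 2 * x i) (by rw [abs_mul]; simp)
    have h2 := shiftedSq_rpow_le hd x i (u := -(2 * x i)) (by rw [abs_neg, abs_mul]; simp)
    rw [← sub_eq_add_neg] at h2
    refine (add_le_add h1 h2).trans_eq ?_
    field_simp
    ring
  rw [← Finset.mul_sum] at hle
  set s := shiftedSq d x
  have hsum : ∑ i : Fin d, (2 - 1 / (2 * s) + 11 / 32 * (1 + 4 * (x i : ℝ) ^ 2) / s ^ 2) =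
      2 * d - d / (2 * s) + 11 / 32 * (d + 4 * ∑ i, (x i : ℝ) ^ 2) / s ^ 2 := by
    simp only [Finset.sum_add_distrib, Finset.sum_sub_distrib, ← Finset.sum_div, ← Finset.mul_sum]
    simp
    ring
  have hlt : 2 * d - d / (2 * s) + 11 / 32 * (d + 4 * ∑ i, (x i : ℝ) ^ 2) / s ^ 2 < 2 * d := by
    have : 11 / 32 * (d + 4 * ∑ i, (x i : ℝ) ^ 2) / s ^ 2 < d / (2 * s) := by
      rw [div_lt_div_iff₀ (by positivity) (by positivity)]
      nlinarith [mul_pos hs0 hs0]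
    linarith
  rw [hsum] at hle
  have hf : 0 < s ^ (-(1 / 4) : ℝ) := Real.rpow_pos_of_pos hs0 _
  have := hle.trans_lt (mul_lt_mul_of_pos_left hlt hf)
  unfold srwAvg
  rw [one_div, inv_mul_lt_iff₀ (by positivity)]
  linarith

lemma summable_srwP {d : ℕ} (hd : 3 ≤ d) (x y : V d) : Summable fun k => srwP d k x y := by
  set f : V d → ℝ := fun z => shiftedSq d z ^ (-(1 / 4) : ℝ) with hf
  have hf0 : ∀ z, 0 ≤ f z := fun z => by
    simp only [hf, shiftedSq]
    positivity
  have hlt : ∀ z, srwAvg d f z < f z := srwAvg_shiftedSq_rpow_lt hd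
  have hc : 0 < f y - srwAvg d f y := sub_pos.2 (hlt y)
  refine summable_of_sum_range_le (srwP_nonneg d · x y) fun n =>
    sum_srwP_le_of_supersolution (h := fun z => (f y - srwAvg d f y)⁻¹ * f z)
      (fun z => mul_nonneg (inv_nonneg.2 hc.le) (hf0 z)) (fun z => ?_) n x
  rw [srwAvg_const_mul]
  split_ifs with h
  · subst h
    have := inv_mul_cancel₀ hc.ne'
    linarith
  · rw [zero_add]
    exact mul_le_mul_of_nonneg_left (hlt z).le (inv_nonneg.2 hc.le)

/-- The one-step averaging operator of simple random walk on `Z̃^d`. -/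
def tAvg (d : ℕ) (f : V d → ℝ) (v : V d) : ℝ :=
  (1 / (tDeg d v)) * ∑ i : Fin d,
    ((if nOdd (v + unitV d i) ≤ 1 then f (v + unitV d i) else 0) +
      (if nOdd (v - unitV d i) ≤ 1 then f (v - unitV d i) else 0))

lemma tq_succ (d ℓ : ℕ) (v w : V d) : tq d (ℓ + 1) v w = tAvg d (fun z => tq d ℓ z w) v := rfl

lemma hasSum_tq_mul (d ℓ : ℕ) (v : V d) (f : V d → ℝ) :
    HasSum (fun z => tq d ℓ v z * f z) ((tAvg d)^[ℓ] f v) := by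
  induction ℓ generalizing v with
  | zero =>
    convert! hasSum_ite_eq v (f v) using 2 with z
    simp only [tq, ite_mul, one_mul, zero_mul, eq_comm (a := v)]
    split_ifs with h
    · rw [h]
    · rfl
  | succ ℓ ih =>
    rw [Function.iterate_succ_apply']
    have h : ∀ u : V d, HasSum (fun z => (if nOdd u ≤ 1 then tq d ℓ u z else 0) * f z)
        (if nOdd u ≤ 1 then (tAvg d)^[ℓ] f u else 0) := by
      intro u
      split_ifs
      · exact ih u
      · simp
    convert! (hasSum_sum fun i (_ : i ∈ Finset.univ) =>
      (h (v + unitV d i)).add (h (v - unitV d i))).mul_left (1 / (tDeg d v) : ℝ) using 2 with z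
    simp only [tq, mul_assoc, Finset.sum_mul, add_mul]

lemma tAvg_iterate_tq (d ℓ m : ℕ) (w : V d) :
    (tAvg d)^[ℓ] (fun z => tq d m z w) = fun v => tq d (ℓ + m) v w := by
  induction ℓ with
  | zero => simp
  | succ ℓ ih =>
    rw [Function.iterate_succ_apply', ih, Nat.add_right_comm]
    rfl

/-- Chapman–Kolmogorov for simple random walk on `Z̃^d`. -/
lemma hasSum_tq_mul_tq (d ℓ m : ℕ) (v w : V d) :
    HasSum (fun z => tq d ℓ v z * tq d m z w) (tq d (ℓ + m) v w) := by
  simpa only [tAvg_iterate_tq] using hasSum_tq_mul d ℓ v fun z => tq d m z w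

lemma exists_of_tq_succ_ne_zero {d ℓ : ℕ} {v z : V d} (h : tq d (ℓ + 1) v z ≠ 0) :
    ∃ i, (nOdd (v + unitV d i) ≤ 1 ∧ tq d ℓ (v + unitV d i) z ≠ 0) ∨
      (nOdd (v - unitV d i) ≤ 1 ∧ tq d ℓ (v - unitV d i) z ≠ 0) := by
  contrapose! h
  refine mul_eq_zero_of_right _ (Finset.sum_eq_zero fun i _ => ?_)
  obtain ⟨h1, h2⟩ := h i
  split_ifs with h3 h4 h4 <;> simp_all

lemma finite_support_tq (d ℓ : ℕ) (v : V d) : {z | tq d ℓ v z ≠ 0}.Finite := by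
  induction ℓ generalizing v with
  | zero =>
    refine (finite_singleton v).subset fun z hz => ?_
    by_contra h
    exact hz (if_neg fun h' => h h'.symm)
  | succ ℓ ih =>
    refine (finite_iUnion fun i => (ih (v + unitV d i)).union (ih (v - unitV d i))).subset ?_
    intro z hz
    obtain ⟨i, h | h⟩ := exists_of_tq_succ_ne_zero hz
    · exact mem_iUnion.2 ⟨i, Or.inl h.2⟩
    · exact mem_iUnion.2 ⟨i, Or.inr h.2⟩

lemma two_dvd_nOdd_sub_sum {d : ℕ} (v : V d) : (2 : ℤ) ∣ (nOdd v : ℤ) - ∑ i, v i := by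
  rw [nOdd, Finset.card_filter, Nat.cast_sum, ← Finset.sum_sub_distrib]
  refine Finset.dvd_sum fun i _ => ?_
  split_ifs <;> push_cast <;> omega

lemma nOdd_add_unitV_mod_two {d : ℕ} (v : V d) (i : Fin d) :
    (nOdd (v + unitV d i) + nOdd v) % 2 = 1 := by
  have h1 := two_dvd_nOdd_sub_sum (v + unitV d i)
  have h2 := two_dvd_nOdd_sub_sum v
  have h3 : ∑ j, (v + unitV d i) j = ∑ j, v j + 1 := by
    simp [unitV, Finset.sum_add_distrib]
  omega

lemma nOdd_sub_unitV_mod_two {d : ℕ} (v : V d) (i : Fin d) :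
    (nOdd (v - unitV d i) + nOdd v) % 2 = 1 := by
  have h := nOdd_add_unitV_mod_two (v - unitV d i) i
  rwa [sub_add_cancel, add_comm] at h

lemma nOdd_of_tq_ne_zero {d ℓ : ℕ} {v z : V d} (hv : nOdd v ≤ 1) (h : tq d ℓ v z ≠ 0) :
    nOdd z ≤ 1 ∧ (nOdd v + nOdd z + ℓ) % 2 = 0 := by
  induction ℓ generalizing v with
  | zero =>
    obtain rfl : v = z := by
      by_contra h'
      exact h (if_neg h')
    exact ⟨hv, by omega⟩
  | succ ℓ ih =>
    obtain ⟨i, h | h⟩ := exists_of_tq_succ_ne_zero h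
    · have := ih h.1 h.2
      have := nOdd_add_unitV_mod_two v i
      omega
    · have := ih h.1 h.2
      have := nOdd_sub_unitV_mod_two v i
      omega

lemma tDeg_ne_zero {d : ℕ} (hd : d ≠ 0) (v : V d) : (tDeg d v : ℝ) ≠ 0 := by
  unfold tDeg
  split_ifs <;> simp [hd]

/-- The one-step forward equation for simple random walk on `Z̃^d`. -/
lemma tq_succ_eq_sum {d n : ℕ} {v w : V d} (hv : nOdd v ≤ 1) :
    tq d (n + 1) w v = ∑ i : Fin d,
      (tq d n w (v + unitV d i) / tDeg d (v + unitV d i) +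
        tq d n w (v - unitV d i) / tDeg d (v - unitV d i)) := by
  refine (hasSum_tq_mul_tq d n 1 w v).unique ?_
  have h : ∀ t : V d, HasSum (fun u => if u = t then tq d n w t / tDeg d t else 0)
      (tq d n w t / tDeg d t) := fun t => hasSum_ite_eq t _
  convert! hasSum_sum fun i (_ : i ∈ Finset.univ) =>
    (h (v + unitV d i)).add (h (v - unitV d i)) using 2 with u
  have h1 : ∀ i, (if nOdd (u + unitV d i) ≤ 1 then tq d 0 (u + unitV d i) v else 0) =
      if u = v - unitV d i then (1 : ℝ) else 0 := by
    intro i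
    simp only [tq, eq_sub_iff_add_eq]
    split_ifs <;> simp_all
  have h2 : ∀ i, (if nOdd (u - unitV d i) ≤ 1 then tq d 0 (u - unitV d i) v else 0) =
      if u = v + unitV d i then (1 : ℝ) else 0 := by
    intro i
    simp only [tq, ← sub_eq_iff_eq_add]
    split_ifs <;> simp_all
  rw [tq_succ, tAvg]
  simp only [h1, h2, Finset.mul_sum]
  refine Finset.sum_congr rfl fun i _ => ?_
  rw [add_comm, mul_add, mul_add]
  congr 1 <;>
  · split_ifs with h3
    · rw [h3]; ring
    · simp

/-- Reversibility of simple random walk on `Z̃^d` with respect to the degree measure. -/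
lemma tDeg_mul_tq_comm {d : ℕ} (hd : d ≠ 0) (n : ℕ) {v w : V d} (hv : nOdd v ≤ 1)
    (hw : nOdd w ≤ 1) : tDeg d v * tq d n v w = tDeg d w * tq d n w v := by
  induction n generalizing v with
  | zero =>
    simp only [tq, eq_comm (a := w)]
    split_ifs with h
    · rw [h]
    · simp
  | succ n ih =>
    have h : ∀ u : V d, (if nOdd u ≤ 1 then tq d n u w else 0) =
        tDeg d w * (tq d n w u / tDeg d u) := by
      intro u
      split_ifs with hu
      · rw [← mul_div_assoc, ← ih hu, mul_div_cancel_left₀ _ (tDeg_ne_zero hd u)]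
      · have : tq d n w u = 0 := by
          by_contra h'
          exact hu (nOdd_of_tq_ne_zero hw h').1
        simp [this]
    rw [tq_succ_eq_sum hv, tq, ← mul_assoc, mul_one_div_cancel (tDeg_ne_zero hd v), one_mul,
      Finset.mul_sum]
    simp only [h, mul_add]

lemma nOdd_eq_zero {d : ℕ} {v : V d} (h : ∀ k, v k % 2 = 0) : nOdd v = 0 := by
  simp [nOdd, h]

lemma nOdd_eq_one {d : ℕ} {v : V d} {i : Fin d} (hi : v i % 2 ≠ 0)
    (h : ∀ k, k ≠ i → v k % 2 = 0) : nOdd v = 1 := by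
  rw [nOdd, Finset.card_eq_one]
  refine ⟨i, Finset.ext fun k => ?_⟩
  simp only [Finset.mem_filter, Finset.mem_univ, true_and, Finset.mem_singleton]
  exact ⟨fun hk => by_contra fun hki => hk (h k hki), fun hk => hk ▸ hi⟩

lemma one_lt_nOdd {d : ℕ} {v : V d} {i j : Fin d} (hij : i ≠ j) (hi : v i % 2 ≠ 0)
    (hj : v j % 2 ≠ 0) : 1 < nOdd v :=
  Finset.one_lt_card.2 ⟨i, by simpa using hi, j, by simpa using hj, hij⟩

lemma nOdd_dbl {d : ℕ} (x : V d) : nOdd (dbl x) = 0 :=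
  nOdd_eq_zero fun k => by simp [dbl]

lemma tAvg_dbl {d : ℕ} (f : V d → ℝ) (x : V d) :
    tAvg d f (dbl x) =
      (1 / (2 * d)) * ∑ i, (f (dbl x + unitV d i) + f (dbl x - unitV d i)) := by
  have h : ∀ i, nOdd (dbl x + unitV d i) = 1 ∧ nOdd (dbl x - unitV d i) = 1 := by
    intro i
    constructor <;> refine nOdd_eq_one (i := i) ?_ fun k hk => ?_ <;>
      simp [dbl, unitV, *]
  simp [tAvg, tDeg, nOdd_dbl, h]

lemma tAvg_midpoint {d : ℕ} (f : V d → ℝ) {v : V d} {i : Fin d} (hi : v i % 2 ≠ 0)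
    (h : ∀ k, k ≠ i → v k % 2 = 0) :
    tAvg d f v = (1 / 2) * (f (v + unitV d i) + f (v - unitV d i)) := by
  have h1 : nOdd v = 1 := nOdd_eq_one hi h
  have h2 : nOdd (v + unitV d i) = 0 ∧ nOdd (v - unitV d i) = 0 := by
    constructor <;> refine nOdd_eq_zero fun k => ?_ <;> by_cases hk : k = i
    · subst hk; simp [unitV]; omega
    · simp [unitV, hk, h k hk]
    · subst hk; simp [unitV]; omega
    · simp [unitV, hk, h k hk]
  rw [tAvg, Finset.sum_eq_single i]
  · simp [tDeg, h1, h2]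
  · intro j _ hj
    have hj2 := h j hj
    have h3 : 1 < nOdd (v + unitV d j) ∧ 1 < nOdd (v - unitV d j) := by
      constructor <;> refine one_lt_nOdd hj ?_ ?_ <;> simp [unitV, hj.symm] <;> omega
    rw [if_neg h3.1.not_ge, if_neg h3.2.not_ge, add_zero]
  · simp

lemma tq_two_mul_eq_lazyP {d : ℕ} (hd : d ≠ 0) (ℓ : ℕ) (x y : V d) :
    tq d (2 * ℓ) (dbl x) (dbl y) = lazyP d ℓ x y := by
  induction ℓ generalizing x with
  | zero =>
    have : dbl x = dbl y ↔ x = y := by simp [dbl, funext_iff]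
    simp [tq, lazyP, this]
  | succ ℓ ih =>
    have hmid : ∀ i, ∀ k, k ≠ i →
        (dbl x + unitV d i) k % 2 = 0 ∧ (dbl x - unitV d i) k % 2 = 0 := by
      intro i k hk
      simp [dbl, unitV, hk]
    have hodd : ∀ i, (dbl x + unitV d i) i % 2 ≠ 0 ∧ (dbl x - unitV d i) i % 2 ≠ 0 := by
      intro i
      simp [dbl, unitV]
    have hp : ∀ i, dbl x + unitV d i + unitV d i = dbl (x + unitV d i) := by
      intro i
      funext k
      simp only [dbl, Pi.add_apply]
      ring
    have hm : ∀ i, dbl x - unitV d i - unitV d i = dbl (x - unitV d i) := by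
      intro i
      funext k
      simp only [dbl, Pi.sub_apply]
      ring
    have hstep : ∀ i, tq d (2 * ℓ + 1) (dbl x + unitV d i) (dbl y) +
        tq d (2 * ℓ + 1) (dbl x - unitV d i) (dbl y) =
        lazyP d ℓ x y + (1 / 2) * (lazyP d ℓ (x + unitV d i) y + lazyP d ℓ (x - unitV d i) y) := by
      intro i
      rw [tq_succ, tq_succ, tAvg_midpoint _ (hodd i).1 fun k hk => (hmid i k hk).1,
        tAvg_midpoint _ (hodd i).2 fun k hk => (hmid i k hk).2, add_sub_cancel_right,
        sub_add_cancel, hp, hm, ih, ih, ih]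
      ring
    have hd' : (d : ℝ) ≠ 0 := Nat.cast_ne_zero.2 hd
    rw [mul_add, mul_one, ← Nat.add_assoc _ 1 1, tq_succ, tAvg_dbl]
    simp only [hstep, lazyP, Finset.sum_add_distrib (f := fun _ => lazyP d ℓ x y),
      ← Finset.mul_sum, Finset.sum_const, Finset.card_univ, Fintype.card_fin, nsmul_eq_mul]
    field_simp
    ring

lemma dinf_le_of_lazyP_ne_zero {d ℓ : ℕ} {x y : V d} (h : lazyP d ℓ x y ≠ 0) :
    dinf x y ≤ ℓ := by
  rw [dinf, Finset.sup_le_iff]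
  intro j _
  induction ℓ generalizing x with
  | zero =>
    obtain rfl : x = y := by
      by_contra h'
      exact h (if_neg h')
    simp
  | succ ℓ ih =>
    by_contra hlt
    refine h ?_
    have h0 : lazyP d ℓ x y = 0 := by
      by_contra h'
      have := ih h'
      omega
    have h1 : ∀ i, lazyP d ℓ (x + unitV d i) y = 0 := by
      intro i
      by_contra h'
      have := ih h'
      simp only [Pi.add_apply, unitV] at this
      split_ifs at this <;> omega
    have h2 : ∀ i, lazyP d ℓ (x - unitV d i) y = 0 := by
      intro i
      by_contra h'
      have := ih h'
      simp only [Pi.sub_apply, unitV] at this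
      split_ifs at this <;> omega
    simp [lazyP, h0, h1, h2]

lemma IsIIDStdGauss.memLp_two {Ω ι : Type*} [MeasurableSpace Ω] {P : Measure Ω} {Z : ι → Ω → ℝ}
    (hZ : IsIIDStdGauss P Z) (i : ι) : MemLp (Z i) 2 P := by
  have h := memLp_id_gaussianReal' (μ := 0) (v := 1) 2 (by simp)
  rw [← hZ.2.1 i, memLp_map_measure_iff aestronglyMeasurable_id (hZ.1 i).aemeasurable] at h
  exact h

lemma IsIIDStdGauss.integral_mul {Ω ι : Type*} [DecidableEq ι] [MeasurableSpace Ω] {P : Measure Ω}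
    {Z : ι → Ω → ℝ} (hZ : IsIIDStdGauss P Z) (i j : ι) :
    ∫ ω, Z i ω * Z j ω ∂P = if i = j then 1 else 0 := by
  have h1 : ∀ i, ∫ ω, Z i ω ∂P = 0 := by
    intro i
    have h := integral_map (μ := P) (hZ.1 i).aemeasurable (f := id) aestronglyMeasurable_id
    rw [hZ.2.1 i] at h
    simpa using h.symm
  split_ifs with hij
  · subst hij
    have h := integral_map (μ := P) (hZ.1 i).aemeasurable (f := fun t : ℝ => t ^ 2)
      (by fun_prop)
    rw [hZ.2.1 i] at h
    have hv := variance_eq_sub (memLp_id_gaussianReal (μ := 0) (v := 1) 2)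
    simp only [variance_id_gaussianReal] at hv
    simp only [← pow_two]
    rw [← h]
    simpa using hv.symm
  · rw [(hZ.2.2.indepFun hij).integral_fun_mul_eq_mul_integral
      (hZ.1 i).aestronglyMeasurable (hZ.1 j).aestronglyMeasurable, h1, zero_mul]

lemma integral_xiF_mul_xiF {d : ℕ} (hd : d ≠ 0) {Ω : Type*} [MeasurableSpace Ω]
    {P : Measure Ω} {Z : ℕ → V d → Ω → ℝ}
    (hZ : IsIIDStdGauss P fun p : ℕ × V d => Z p.1 p.2) (ℓ : ℕ) (x y : V d) :
    ∫ ω, xiF d Z ℓ x ω * xiF d Z ℓ y ω ∂P = (1 / 2) * tq d (2 * ℓ) (dbl x) (dbl y) := by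
  classical
  set F : Finset (V d) :=
    (finite_support_tq d ℓ (dbl x)).toFinset ∪ (finite_support_tq d ℓ (dbl y)).toFinset with hF
  have hFx : ∀ z ∉ F, tq d ℓ (dbl x) z = 0 := fun z hz => by
    by_contra h
    exact hz (by simp [hF, h])
  have hFy : ∀ z ∉ F, tq d ℓ (dbl y) z = 0 := fun z hz => by
    by_contra h
    exact hz (by simp [hF, h])
  set c : ℝ := if ℓ % 2 = 1 then Real.sqrt (d / 2) else Real.sqrt (1 / 2) with hc
  have hmul : ∀ ω, xiF d Z ℓ x ω * xiF d Z ℓ y ω = ∑ z ∈ F, ∑ z' ∈ F,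
      c ^ 2 * tq d ℓ (dbl x) z * tq d ℓ (dbl y) z' * (Z ℓ z ω * Z ℓ z' ω) := by
    intro ω
    rw [xiF, xiF, tsum_eq_sum (s := F) fun z hz => by rw [hFx z hz, zero_mul],
      tsum_eq_sum (s := F) fun z hz => by rw [hFy z hz, zero_mul], ← hc,
      mul_mul_mul_comm, Finset.sum_mul_sum, Finset.mul_sum]
    refine Finset.sum_congr rfl fun z _ => ?_
    rw [Finset.mul_sum]
    refine Finset.sum_congr rfl fun z' _ => ?_
    ring
  have hint : ∀ z z', Integrable (fun ω => Z ℓ z ω * Z ℓ z' ω) P := fun z z' =>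
    (hZ.memLp_two (ℓ, z)).integrable_mul (hZ.memLp_two (ℓ, z'))
  have hcov : ∀ z z', ∫ ω, Z ℓ z ω * Z ℓ z' ω ∂P = if z = z' then 1 else 0 := fun z z' => by
    simpa using hZ.integral_mul (ℓ, z) (ℓ, z')
  have hck : tq d (2 * ℓ) (dbl x) (dbl y) =
      ∑ z ∈ F, tq d ℓ (dbl x) z * tq d ℓ z (dbl y) := by
    rw [two_mul]
    exact (hasSum_tq_mul_tq d ℓ ℓ _ _).unique
      (hasSum_sum_of_ne_finset_zero fun z hz => by rw [hFx z hz, zero_mul])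
  simp only [hmul]
  rw [integral_finsetSum _ fun z _ => integrable_finsetSum _ fun z' _ => (hint z z').const_mul _,
    hck, Finset.mul_sum]
  refine Finset.sum_congr rfl fun z hz => ?_
  rw [integral_finsetSum _ fun z' _ => (hint z z').const_mul _]
  simp only [integral_const_mul, hcov, mul_ite, mul_one, mul_zero, Finset.sum_ite_eq, hz, if_true]
  by_cases h0 : tq d ℓ (dbl x) z = 0
  · simp [h0]
  obtain ⟨hz1, hz2⟩ := nOdd_of_tq_ne_zero ((nOdd_dbl x).trans_le zero_le_one) h0
  have hrev := tDeg_mul_tq_comm hd ℓ hz1 ((nOdd_dbl y).trans_le zero_le_one)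
  have hd' : (d : ℝ) ≠ 0 := Nat.cast_ne_zero.2 hd
  rw [nOdd_dbl] at hz2
  suffices h : c ^ 2 * tq d ℓ (dbl y) z = (1 / 2) * tq d ℓ z (dbl y) by
    linear_combination tq d ℓ (dbl x) z * h
  simp only [tDeg, nOdd_dbl, if_true] at hrev
  by_cases hℓ : ℓ % 2 = 1
  · rw [if_neg (by omega)] at hrev
    rw [hc, if_pos hℓ, Real.sq_sqrt (by positivity)]
    push_cast at hrev
    linarith
  · rw [if_pos (by omega)] at hrev
    rw [hc, if_neg hℓ, Real.sq_sqrt (by norm_num)]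
    push_cast at hrev
    rw [mul_left_cancel₀ (mul_ne_zero two_ne_zero hd') hrev]

/-- The computations underlying Lemma 3.1: `E[ξ^ℓ_x ξ^ℓ_y] = (1/2) q̃_{2ℓ}(x,y)`, the
identification `q̃_{2ℓ} = q_ℓ` (lazy walk kernel) on `ℤ^d`, the identity
`g(x,y) = (1/2) Σ_ℓ q_ℓ(x,y)` (the series converging), and the resulting finite range
property `E[ξ^ℓ_x ξ^ℓ_y] = 0` for `|x - y|_∞ > ℓ`. -/
theorem xi_covariance (d : ℕ) (hd : 3 ≤ d) {Ω : Type*} [MeasurableSpace Ω]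
    (P : Measure Ω) [IsProbabilityMeasure P] (Z : ℕ → V d → Ω → ℝ)
    (hZ : IsIIDStdGauss P fun p : ℕ × V d => Z p.1 p.2) :
    (∀ (ℓ : ℕ) (x y : V d),
        ∫ ω, xiF d Z ℓ x ω * xiF d Z ℓ y ω ∂P = (1 / 2) * tq d (2 * ℓ) (dbl x) (dbl y)) ∧
    (∀ (ℓ : ℕ) (x y : V d), tq d (2 * ℓ) (dbl x) (dbl y) = lazyP d ℓ x y) ∧
    (∀ x y : V d, HasSum (fun ℓ : ℕ => (1 / 2) * lazyP d ℓ x y) (green d x y)) ∧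
    (∀ (ℓ : ℕ) (x y : V d), ℓ < dinf x y →
        ∫ ω, xiF d Z ℓ x ω * xiF d Z ℓ y ω ∂P = 0) := by
  have hd0 : d ≠ 0 := by omega
  refine ⟨integral_xiF_mul_xiF hd0 hZ, tq_two_mul_eq_lazyP hd0,
    fun x y => hasSum_half_lazyP (fun z => summable_srwP hd z y) x, fun ℓ x y hlt => ?_⟩
  rw [integral_xiF_mul_xiF hd0 hZ, tq_two_mul_eq_lazyP hd0]
  have : lazyP d ℓ x y = 0 := by
    by_contra h
    exact hlt.not_ge (dinf_le_of_lazyP_ne_zero h)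
  rw [this, mul_zero]

end
end GFFperc
end

section
/- Let d ≥ 3, L ≥ 0, M ≥ 0 and let ω be a {0,1}^{Z^d}-valued random field whose law is invariant under translations of Z^d and which is L-dependent. Let S := Z² × {0,…,M}^{d−2} and suppose θ_S := P[0 ↔ ∞ in {x : ω_x = 1} ∩ S] > 0. Then for all integers 1 ≤ u ≤ R: P[B_u is not joined to ∂B_R by a path in {x : ω_x = 1}] ≤ (1 − θ_S)^{⌊u/(M+L+1)⌋}. -/
open MeasureTheory ProbabilityTheory Filter Set

namespace GFFperc

noncomputable section

/-- `X` is `L`-dependent: restrictions to sets at pairwise `ℓ∞`-distance greater than `L`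
are independent. -/
def LDep {Ω : Type*} [MeasurableSpace Ω] {d : ℕ} (P : Measure Ω) (X : V d → Ω → Bool)
    (L : ℕ) : Prop :=
  ∀ (n : ℕ) (A : Fin n → Set (V d)),
    (∀ i j, i ≠ j → ∀ a ∈ A i, ∀ b ∈ A j, L < dinf a b) →
    iIndepFun (fun i ω => fun a : ↥(A i) => X a.1 ω) P

/-- The law of `X` is invariant under translations of `ℤ^d`. -/
def TransInv {Ω : Type*} [MeasurableSpace Ω] {d : ℕ} (P : Measure Ω)
    (X : V d → Ω → Bool) : Prop :=
  ∀ v : V d, Measure.map (fun ω => fun x => X (x + v) ω) P =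
    Measure.map (fun ω => fun x => X x ω) P

/-- The slab `ℤ² × {0,…,M}^{d-2}`. -/
def slab (d M : ℕ) : Set (V d) := {x | ∀ i : Fin d, 2 ≤ (i : ℕ) → 0 ≤ x i ∧ x i ≤ M}

lemma ConnIn.mono {d : ℕ} {S T A B : Set (V d)} (h : S ⊆ T) : ConnIn S A B → ConnIn T A B := by
  rintro ⟨n, γ, hA, hB, hS, hadj⟩
  exact ⟨n, γ, hA, hB, fun k hk => h (hS k hk), hadj⟩

/-- A connection inside `S` uses only finitely many sites of `S`. -/
lemma connIn_iff_exists_finset {d : ℕ} {S A B : Set (V d)} :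
    ConnIn S A B ↔ ∃ s : Finset (V d), ConnIn (s : Set (V d)) A B ∧ ∀ x ∈ s, x ∈ S := by
  classical
  constructor
  · rintro ⟨n, γ, hA, hB, hS, hadj⟩
    refine ⟨(Finset.range (n + 1)).image γ, ⟨n, γ, hA, hB, fun k hk => ?_, hadj⟩, fun x hx => ?_⟩
    · exact Finset.mem_coe.2 (Finset.mem_image_of_mem γ (Finset.mem_range.2 (by omega)))
    · obtain ⟨k, hk, rfl⟩ := Finset.mem_image.1 hx
      exact hS k (by have := Finset.mem_range.1 hk; omega)
  · rintro ⟨s, hs, hsS⟩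
    exact hs.mono hsS

lemma measurableSet_connIn {d : ℕ} {α : Type*} [MeasurableSpace α] {S : α → Set (V d)}
    (hS : ∀ x, MeasurableSet {a | x ∈ S a}) (A B : Set (V d)) :
    MeasurableSet {a | ConnIn (S a) A B} := by
  have h : {a | ConnIn (S a) A B} =
      ⋃ s : {s : Finset (V d) // ConnIn (s : Set (V d)) A B}, ⋂ x ∈ s.1, {a | x ∈ S a} := by
    ext a
    simp only [mem_ofPred_eq, mem_iUnion, mem_iInter, Subtype.exists, exists_prop]
    exact connIn_iff_exists_finset
  rw [h]
  exact MeasurableSet.iUnion fun s => Finset.measurableSet_biInter _ fun x _ => hS x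

lemma measurableSet_connToInf {d : ℕ} {α : Type*} [MeasurableSpace α] {S : α → Set (V d)}
    (hS : ∀ x, MeasurableSet {a | x ∈ S a}) (A : Set (V d)) :
    MeasurableSet {a | ConnToInf (S a) A} := by
  have h : {a | ConnToInf (S a) A} =
      ⋂ R : ℕ, ⋂ _ : 1 ≤ R, {a | ConnIn (S a) A (bdry d R)} := by
    ext a
    simp [ConnToInf]
  rw [h]
  exact MeasurableSet.iInter fun R => MeasurableSet.iInter fun _ => measurableSet_connIn hS _ _

lemma mem_box_natCast {d : ℕ} {r : ℕ} {x : V d} : x ∈ box d (r : ℝ) ↔ ∀ i, |x i| ≤ (r : ℤ) := by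
  refine forall_congr' fun i => ?_
  simp only [Pi.zero_apply, Int.cast_zero, sub_zero]
  exact_mod_cast Iff.rfl

lemma adj.natAbs_sub_le {d : ℕ} {x y : V d} (h : adj x y) (i : Fin d) :
    (x i - y i).natAbs ≤ 1 := by
  rw [← h]
  exact Finset.single_le_sum (f := fun i => (x i - y i).natAbs) (fun _ _ => Nat.zero_le _)
    (Finset.mem_univ i)

lemma exists_le_abs_of_mem_bdry {d : ℕ} {r : ℕ} {x : V d} (hx : x ∈ bdry d (r : ℝ)) :
    ∃ i, (r : ℤ) ≤ |x i| := by
  obtain ⟨-, z, hz, hxz⟩ := hx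
  have hz' : ¬ ∀ i, |z i| ≤ (r : ℤ) := fun h => hz (mem_box_natCast.2 h)
  push Not at hz'
  obtain ⟨i, hi⟩ := hz'
  have := hxz.natAbs_sub_le i
  rw [Int.abs_eq_natAbs] at hi
  exact ⟨i, by rw [Int.abs_eq_natAbs]; omega⟩

/-- A path that starts in a box and leaves it visits the inner boundary of the box. -/
lemma ConnIn.bdry_of_exit {d : ℕ} {S A B : Set (V d)} {r : ℝ} (hA : A ⊆ box d r)
    (hB : Disjoint B (box d r)) (h : ConnIn S A B) : ConnIn S A (bdry d r) := by
  classical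
  obtain ⟨n, γ, h0, hn, hS, hadj⟩ := h
  have hex : ∃ k, γ k ∉ box d r := ⟨n, Set.disjoint_left.1 hB hn⟩
  have hle : Nat.find hex ≤ n := Nat.find_min' hex (Set.disjoint_left.1 hB hn)
  have hout := Nat.find_spec hex
  obtain ⟨m, hm⟩ : ∃ m, Nat.find hex = m + 1 :=
    Nat.exists_eq_succ_of_ne_zero fun h => by rw [h] at hout; exact hout (hA h0)
  have hin : γ m ∈ box d r := not_not.1 (Nat.find_min hex (by omega))
  rw [hm] at hout
  exact ⟨m, γ, h0, ⟨hin, γ (m + 1), hout, hadj m (by omega)⟩, fun k hk => hS k (by omega),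
    fun k hk => hadj k (by omega)⟩

/-- An infinite cluster of the configuration seen from `v ∈ B_u` connects `B_u` to `∂B_R`. -/
lemma ConnToInf.connIn_bdry {d : ℕ} {S T : Set (V d)} {v : V d} {u R : ℕ} (huR : u ≤ R)
    (hv : v ∈ box d (u : ℝ)) (hST : ∀ x ∈ S, x + v ∈ T) (h : ConnToInf S {0}) :
    ConnIn T (box d (u : ℝ)) (bdry d (R : ℝ)) := by
  have hv' := mem_box_natCast.1 hv
  obtain ⟨n, γ, h0, hn, hS, hadj⟩ := h (2 * R + 1) (by omega)
  have hfar : γ n + v ∉ box d (R : ℝ) := fun hmem => by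
    obtain ⟨i, hi⟩ := exists_le_abs_of_mem_bdry hn
    have h1 := mem_box_natCast.1 hmem i
    have h2 := hv' i
    rw [Pi.add_apply] at h1
    push_cast at hi
    rw [abs_le] at h1 h2
    rw [le_abs] at hi
    omega
  refine ConnIn.bdry_of_exit (B := {γ n + v}) (fun x hx => ?_)
    (Set.disjoint_singleton_left.2 hfar)
    ⟨n, fun k => γ k + v, ?_, rfl, fun k hk => hST _ (hS k hk), fun k hk => ?_⟩
  · exact mem_box_natCast.2 fun i => (mem_box_natCast.1 hx i).trans (by exact_mod_cast huR)
  · rw [mem_singleton_iff] at h0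
    simpa [h0] using hv
  · simpa [adj] using hadj k hk

/-- Percolation in a slab is equally likely from every point of view. -/
lemma TransInv.measure_connToInf {d : ℕ} {Ω : Type*} [MeasurableSpace Ω] {P : Measure Ω}
    {X : V d → Ω → Bool} (hmeas : ∀ x, Measurable (X x)) (hTI : TransInv P X) (S : Set (V d))
    (v : V d) :
    P {ω | ConnToInf ({x | X (x + v) ω = true} ∩ S) {(0 : V d)}} =
      P {ω | ConnToInf ({x | X x ω = true} ∩ S) {(0 : V d)}} := by
  have hE : MeasurableSet {f : V d → Bool | ConnToInf ({x | f x = true} ∩ S) {(0 : V d)}} := by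
    refine measurableSet_connToInf (fun x => ?_) _
    exact (measurableSet_eq_fun (measurable_pi_apply x) measurable_const).inter
      (MeasurableSet.const (x ∈ S))
  have h := congrArg (fun μ => μ {f : V d → Bool | ConnToInf ({x | f x = true} ∩ S) {0}}) (hTI v)
  rwa [Measure.map_apply (measurable_pi_lambda _ fun x => hmeas (x + v)) hE,
    Measure.map_apply (measurable_pi_lambda _ hmeas) hE] at h

/-- Failures to percolate in translated slabs at pairwise distance greater than `L` are
independent. -/
lemma LDep.measure_iInter_not_connToInf {d : ℕ} {Ω : Type*} [MeasurableSpace Ω] {P : Measure Ω}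
    {X : V d → Ω → Bool} {L : ℕ} (hLD : LDep P X L) {n : ℕ} (S : Set (V d)) (v : Fin n → V d)
    (hsep : ∀ i j, i ≠ j → ∀ a ∈ S, ∀ b ∈ S, L < dinf (a + v i) (b + v j)) :
    P (⋂ i, {ω | ConnToInf ({x | X (x + v i) ω = true} ∩ S) {(0 : V d)}}ᶜ) =
      ∏ i, P {ω | ConnToInf ({x | X (x + v i) ω = true} ∩ S) {(0 : V d)}}ᶜ := by
  classical
  let A : Fin n → Set (V d) := fun i => {y | ∃ x ∈ S, x + v i = y}
  have hind := hLD n A (by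
    rintro i j hij _ ⟨a, ha, rfl⟩ _ ⟨b, hb, rfl⟩
    exact hsep i j hij a ha b hb)
  let F : ∀ i, (A i → Bool) → Set (V d) :=
    fun i g => {x | ∃ hx : x ∈ S, g ⟨x + v i, x, hx, rfl⟩ = true}
  have hF : ∀ i, MeasurableSet {g | ConnToInf (F i g) {(0 : V d)}}ᶜ := by
    refine fun i => (measurableSet_connToInf (fun x => ?_) _).compl
    by_cases hx : x ∈ S
    · simp only [F, mem_ofPred_eq, hx, exists_true_left]
      exact measurableSet_eq_fun (measurable_pi_apply _) measurable_const
    · simp [F, hx]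
  have hpre : ∀ i, (fun ω => fun a : A i => X a.1 ω) ⁻¹' {g | ConnToInf (F i g) {(0 : V d)}}ᶜ =
      {ω | ConnToInf ({x | X (x + v i) ω = true} ∩ S) {(0 : V d)}}ᶜ := by
    intro i
    ext ω
    have : F i (fun a : A i => X a.1 ω) = {x | X (x + v i) ω = true} ∩ S := by
      ext x
      simp [F, and_comm]
    simp [this]
  have h := hind.measure_inter_preimage_eq_mul Finset.univ (fun i _ => hF i)
  simpa only [hpre, Finset.mem_univ, iInter_true] using h

/-- Percolation in slabs implies (exponential) decay of disconnection probabilities for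
translation-invariant `L`-dependent site percolation. -/
theorem slab_percolation_decay (d : ℕ) (hd : 3 ≤ d) {Ω : Type*} [MeasurableSpace Ω]
    (P : Measure Ω) [IsProbabilityMeasure P] (X : V d → Ω → Bool) (L M : ℕ)
    (hmeas : ∀ x, Measurable (X x)) (hTI : TransInv P X) (hLD : LDep P X L)
    (hθ : 0 < P {ω | ConnToInf ({x | X x ω = true} ∩ slab d M) {(0 : V d)}}) :
    ∀ u R : ℕ, 1 ≤ u → u ≤ R →
      P {ω | ¬ ConnIn {x | X x ω = true} (box d (u : ℝ)) (bdry d (R : ℝ))} ≤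
        (1 - P {ω | ConnToInf ({x | X x ω = true} ∩ slab d M) {(0 : V d)}}) ^
          (u / (M + L + 1)) := by
  intro u R hu huR
  let e : Fin d := ⟨2, hd⟩
  let v : Fin (u / (M + L + 1)) → V d := fun k => Pi.single e ((k : ℤ) * (M + L + 1))
  have hv : ∀ k, v k ∈ box d (u : ℝ) := by
    refine fun k => mem_box_natCast.2 fun i => ?_
    have hk : (k : ℕ) * (M + L + 1) ≤ u :=
      (Nat.mul_le_mul_right _ k.2.le).trans (Nat.div_mul_le_self _ _)
    have hk' : (k : ℤ) * (M + L + 1) ≤ u := by exact_mod_cast hk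
    by_cases hi : i = e
    · subst hi
      simp only [v, Pi.single_eq_same]
      rwa [abs_of_nonneg (by positivity)]
    · simp [v, Pi.single_eq_of_ne hi]
  have hsep : ∀ i j, i ≠ j → ∀ a ∈ slab d M, ∀ b ∈ slab d M, L < dinf (a + v i) (b + v j) := by
    intro i j hij a ha b hb
    have hle : ((a + v i) e - (b + v j) e).natAbs ≤ dinf (a + v i) (b + v j) :=
      Finset.le_sup (f := fun l => ((a + v i) l - (b + v j) l).natAbs) (Finset.mem_univ e)
    refine lt_of_lt_of_le ?_ hle
    have ha' := ha e le_rfl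
    have hb' := hb e le_rfl
    simp only [Pi.add_apply, v, Pi.single_eq_same]
    have hK : (0 : ℤ) ≤ M + L + 1 := by positivity
    rcases lt_or_gt_of_ne (Fin.val_ne_of_ne hij) with h | h
    · have := mul_le_mul_of_nonneg_right (show (i : ℤ) + 1 ≤ j by exact_mod_cast h) hK
      rw [add_mul, one_mul] at this
      omega
    · have := mul_le_mul_of_nonneg_right (show (j : ℤ) + 1 ≤ i by exact_mod_cast h) hK
      rw [add_mul, one_mul] at this
      omega
  have hE : ∀ k, MeasurableSet
      {ω | ConnToInf ({x | X (x + v k) ω = true} ∩ slab d M) {(0 : V d)}} := fun k =>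
    measurableSet_connToInf (fun x =>
      (measurableSet_eq_fun (hmeas (x + v k)) measurable_const).inter
        (MeasurableSet.const (x ∈ slab d M))) _
  calc P {ω | ¬ ConnIn {x | X x ω = true} (box d (u : ℝ)) (bdry d (R : ℝ))}
      ≤ P (⋂ k, {ω | ConnToInf ({x | X (x + v k) ω = true} ∩ slab d M) {(0 : V d)}}ᶜ) := by
        refine measure_mono fun ω hω => mem_iInter.2 fun k hk => hω ?_
        exact ConnToInf.connIn_bdry huR (hv k) (fun x hx => hx.1) hk
    _ = _ := by
        rw [hLD.measure_iInter_not_connToInf (slab d M) v hsep]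
        simp [prob_compl_eq_one_sub (hE _), hTI.measure_connToInf hmeas]

end
end GFFperc
end
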